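/- Fix integers B ≥ 1, C ≥ 1 and m ≥ 1. Let y_i ∈ ℝ^C (i = 1,…,B) be one-hot vectors and let a_{j,i} ∈ ℝ^C (j = 1,…,m, i = 1,…,B) be one-hot vectors such that a_{j,B} ≠ y_B for every j. Let w ∈ ℝ^m satisfy w_j ≥ 0 for all j and Σ_{j=1}^m w_j = 1, and write f_w(i) = Σ_{j=1}^m w_j a_{j,i}. Set g_{new} := (2/(BC)) Σ_{i=1}^B ⟨f_w(i) − y_i, y_i⟩. Then for every step size α > BC/(4m), the weight assigned to the new tree after one gradient step satisfies −α · g_{new} > 1/(2m). -/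

import Mathlib

open scoped BigOperators RealInnerProductSpace

/-- A vector is one-hot if exactly one coordinate equals 1 and all others equal 0. -/
def IsOneHot {C : ℕ} (v : EuclideanSpace ℝ (Fin C)) : Prop :=
  ∃ c : Fin C, v c = 1 ∧ ∀ c' : Fin C, c' ≠ c → v c' = 0

theorem IsOneHot.exists_eq_single {C : ℕ} {v : EuclideanSpace ℝ (Fin C)} (hv : IsOneHot v) :
    ∃ c : Fin C, v = EuclideanSpace.single c 1 := by
  obtain ⟨c, hc, hc'⟩ := hv
  refine ⟨c, ?_⟩
  ext d
  by_cases h : d = c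
  · subst h
    simp [hc]
  · simp [hc' d h, h]

theorem IsOneHot.inner_self {C : ℕ} {v : EuclideanSpace ℝ (Fin C)} (hv : IsOneHot v) :
    ⟪v, v⟫ = 1 := by
  obtain ⟨c, rfl⟩ := hv.exists_eq_single
  simp

theorem IsOneHot.inner_eq_zero {C : ℕ} {u v : EuclideanSpace ℝ (Fin C)} (hu : IsOneHot u)
    (hv : IsOneHot v) (huv : u ≠ v) : ⟪u, v⟫ = 0 := by
  obtain ⟨c, rfl⟩ := hu.exists_eq_single
  obtain ⟨d, rfl⟩ := hv.exists_eq_single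
  have hcd : c ≠ d := fun h => huv (by rw [h])
  rw [EuclideanSpace.inner_single_left]
  simp [hcd]

theorem IsOneHot.inner_le_one {C : ℕ} {u v : EuclideanSpace ℝ (Fin C)} (hu : IsOneHot u)
    (hv : IsOneHot v) : ⟪u, v⟫ ≤ 1 := by
  by_cases h : u = v
  · rw [h, hv.inner_self]
  · rw [hu.inner_eq_zero hv h]
    exact zero_le_one

/-- For any step size `α > BC/(4m)`, the weight `−α·g_new` assigned to the newly
trained tree after one gradient step exceeds `1/(2m)`. -/
theorem shrub_new_tree_weight_gt
    (B C m : ℕ) (hB : 1 ≤ B) (hC : 1 ≤ C) (hm : 1 ≤ m)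
    (y : Fin B → EuclideanSpace ℝ (Fin C))
    (a : Fin m → Fin B → EuclideanSpace ℝ (Fin C))
    (hy : ∀ i, IsOneHot (y i))
    (ha : ∀ j i, IsOneHot (a j i))
    (iB : Fin B) (hiB : (iB : ℕ) = B - 1)
    (hmiss : ∀ j : Fin m, a j iB ≠ y iB)
    (w : Fin m → ℝ) (hw0 : ∀ j, 0 ≤ w j) (hw1 : ∑ j, w j = 1)
    (α : ℝ) (hα : α > ((B : ℝ) * (C : ℝ)) / (4 * (m : ℝ))) :
    -(α * ((2 / ((B : ℝ) * (C : ℝ))) * ∑ i, ⟪(∑ j, w j • a j i) - y i, y i⟫))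
      > 1 / (2 * (m : ℝ)) := by
  have hterm (i : Fin B) :
      ⟪(∑ j, w j • a j i) - y i, y i⟫ = ∑ j, w j * ⟪a j i, y i⟫ - 1 := by
    simp only [inner_sub_left, sum_inner, real_inner_smul_left, (hy i).inner_self]
  have hnonpos (i : Fin B) : ⟪(∑ j, w j • a j i) - y i, y i⟫ ≤ 0 := by
    rw [hterm, sub_nonpos, ← hw1]
    exact Finset.sum_le_sum fun j _ =>
      mul_le_of_le_one_right (hw0 j) ((ha j i).inner_le_one (hy i))
  have hlast : ⟪(∑ j, w j • a j iB) - y iB, y iB⟫ = -1 := by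
    rw [hterm, Finset.sum_eq_zero fun j _ => by
      rw [(ha j iB).inner_eq_zero (hy iB) (hmiss j), mul_zero], zero_sub]
  have hsum : ∑ i, ⟪(∑ j, w j • a j i) - y i, y i⟫ ≤ -1 := by
    rw [← Finset.add_sum_erase _ _ (Finset.mem_univ iB), hlast]
    linarith [Finset.sum_nonpos fun i (_ : i ∈ Finset.univ.erase iB) => hnonpos i]
  have hBC : (0 : ℝ) < B * C := by positivity
  have hm' : (0 : ℝ) < m := by positivity
  have hα0 : 0 < α := lt_trans (by positivity) hα
  calc 1 / (2 * (m : ℝ)) = B * C / (4 * m) * (2 / (B * C)) := by field_simp; norm_num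
    _ < α * (2 / (B * C)) := by gcongr
    _ ≤ α * (2 / (B * C)) * -∑ i, ⟪(∑ j, w j • a j i) - y i, y i⟫ :=
      le_mul_of_one_le_right (by positivity) (by linarith)
    _ = _ := by ring
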